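/- Let n ≥ 3 and let p be a real number with p ≥ 2n/(n−2). Then the system −Δu = −2(u−v) + p v^{p−1}, −Δv = 2(u−v) + p u^{p−1} in ℝ^n, with u > 0 and v > 0 in ℝ^n, admits a twice continuously differentiable radially symmetric solution, i.e. there exist positive C² functions u, v : ℝ^n → ℝ, each depending on x only through |x|, satisfying the system on all of ℝ^n. -/

import Mathlib

noncomputable section
open Set Metric
open scoped BigOperators

/-- The Laplace operator on `ℝ^n`, as the sum of second partial derivatives. -/
def lap {n : ℕ} (u : EuclideanSpace ℝ (Fin n) → ℝ) (x : EuclideanSpace ℝ (Fin n)) : ℝ :=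
  ∑ i, fderiv ℝ (fun y => fderiv ℝ u y (EuclideanSpace.single i 1)) x (EuclideanSpace.single i 1)

/-- The weighted mean `∫₀¹ σ^m f(V(σ s)) dσ`. -/
def weightedMean (m : ℝ) (f V : ℝ → ℝ) (s : ℝ) : ℝ :=
  ∫ σ in (0 : ℝ)..1, σ ^ m * f (V (σ * s))

/-- The Volterra operator `V ↦ 1 - ¼ ∫₀ˢ weightedMean m f V`. -/
def volterraOp (m : ℝ) (f V : ℝ → ℝ) (s : ℝ) : ℝ :=
  1 - 1 / 4 * ∫ t in (0 : ℝ)..s, weightedMean m f V t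

lemma continuous_weightedMean {m : ℝ} (hm : 0 ≤ m) {f V : ℝ → ℝ} (hf : Continuous f)
    (hV : Continuous V) : Continuous (weightedMean m f V) := by
  unfold weightedMean
  apply intervalIntegral.continuous_parametric_intervalIntegral_of_continuous'
  have h := Real.continuous_rpow_const hm
  simp only [Function.uncurry_def]
  fun_prop

lemma continuous_volterraOp {m : ℝ} (hm : 0 ≤ m) {f V : ℝ → ℝ} (hf : Continuous f)
    (hV : Continuous V) : Continuous (volterraOp m f V) := by
  have h := continuous_weightedMean hm hf hV
  have h2 := intervalIntegral.continuous_primitive (μ := MeasureTheory.volume)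
    (fun a b => h.intervalIntegrable a b) 0
  unfold volterraOp
  fun_prop

lemma abs_weightedMean_sub_le {m L C : ℝ} (hm : 0 ≤ m) (hL : 0 ≤ L) (hC : 0 ≤ C)
    {f V W : ℝ → ℝ} (hf : Continuous f) (hlip : ∀ a b, |f a - f b| ≤ L * |a - b|)
    (hV : Continuous V) (hW : Continuous W)
    (h : ∀ s, |V s - W s| ≤ C * Real.exp (L * |s|)) (s : ℝ) :
    |weightedMean m f V s - weightedMean m f W s| ≤ C * (L * Real.exp (L * |s|)) := by
  have hc := Real.continuous_rpow_const hm
  unfold weightedMean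
  rw [← intervalIntegral.integral_sub (Continuous.intervalIntegrable (by fun_prop) _ _)
    (Continuous.intervalIntegrable (by fun_prop) _ _)]
  have := intervalIntegral.norm_integral_le_of_norm_le_const (a := (0 : ℝ)) (b := 1)
    (C := C * (L * Real.exp (L * |s|)))
    (f := fun σ : ℝ => σ ^ m * f (V (σ * s)) - σ ^ m * f (W (σ * s))) ?_
  · simpa using this
  intro σ hσ
  rw [uIoc_of_le zero_le_one] at hσ
  have h1 : σ ^ m ≤ 1 := Real.rpow_le_one hσ.1.le hσ.2 hm
  have h0 : 0 ≤ σ ^ m := Real.rpow_nonneg hσ.1.le m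
  have hs : |σ * s| ≤ |s| := by
    rw [abs_mul, abs_of_pos hσ.1]
    exact mul_le_of_le_one_left (abs_nonneg s) hσ.2
  rw [← mul_sub, Real.norm_eq_abs, abs_mul, abs_of_nonneg h0]
  calc σ ^ m * |f (V (σ * s)) - f (W (σ * s))|
      ≤ 1 * (L * (C * Real.exp (L * |s|))) := by
        gcongr
        refine (hlip _ _).trans ?_
        gcongr
        refine (h _).trans ?_
        gcongr
    _ = C * (L * Real.exp (L * |s|)) := by ring

lemma abs_integral_exp_abs_le (L s : ℝ) :
    |∫ t in (0 : ℝ)..s, L * Real.exp (L * |t|)| ≤ |Real.exp (L * |s|) - 1| := by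
  have key : ∀ r : ℝ, 0 ≤ r →
      ∫ t in (0 : ℝ)..r, L * Real.exp (L * |t|) = Real.exp (L * r) - 1 := by
    intro r hr
    rw [intervalIntegral.integral_congr (g := fun t => L * Real.exp (L * t)),
      intervalIntegral.integral_eq_sub_of_hasDerivAt (f := fun t => Real.exp (L * t))]
    · simp
    · intro t _
      simpa [mul_comm] using ((hasDerivAt_id t).const_mul L).exp
    · exact Continuous.intervalIntegrable (by fun_prop) _ _
    · intro t ht
      rw [uIcc_of_le hr] at ht
      simp [abs_of_nonneg ht.1]
  rcases le_total 0 s with hs | hs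
  · rw [key s hs, abs_of_nonneg hs]
  · have h := intervalIntegral.integral_comp_neg (a := 0) (b := s)
      (fun t => L * Real.exp (L * |t|))
    simp only [abs_neg, neg_zero] at h
    rw [h, intervalIntegral.integral_symm, key (-s) (by linarith), abs_neg, abs_of_nonpos hs]

lemma abs_volterraOp_sub_le {m L C : ℝ} (hm : 0 ≤ m) (hL : 0 ≤ L) (hC : 0 ≤ C)
    {f V W : ℝ → ℝ} (hf : Continuous f) (hlip : ∀ a b, |f a - f b| ≤ L * |a - b|)
    (hV : Continuous V) (hW : Continuous W)
    (h : ∀ s, |V s - W s| ≤ C * Real.exp (L * |s|)) (s : ℝ) :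
    |volterraOp m f V s - volterraOp m f W s| ≤ 1 / 4 * C * Real.exp (L * |s|) := by
  have hMV := continuous_weightedMean hm hf hV
  have hMW := continuous_weightedMean hm hf hW
  have hE : 1 ≤ Real.exp (L * |s|) := Real.one_le_exp (by positivity)
  have heq : volterraOp m f V s - volterraOp m f W s =
      -(1 / 4 * ∫ t in (0 : ℝ)..s, (weightedMean m f V t - weightedMean m f W t)) := by
    rw [intervalIntegral.integral_sub (hMV.intervalIntegrable _ _) (hMW.intervalIntegrable _ _)]
    unfold volterraOp
    ring
  have hint : |∫ t in (0 : ℝ)..s, (weightedMean m f V t - weightedMean m f W t)|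
      ≤ |∫ t in (0 : ℝ)..s, C * (L * Real.exp (L * |t|))| := by
    refine intervalIntegral.norm_integral_le_abs_of_norm_le
      (f := fun t => weightedMean m f V t - weightedMean m f W t)
      (g := fun t => C * (L * Real.exp (L * |t|)))
      (.of_forall fun t => abs_weightedMean_sub_le hm hL hC hf hlip hV hW h t) ?_
    exact Continuous.intervalIntegrable (by fun_prop) _ _
  have hexp := abs_integral_exp_abs_le L s
  rw [intervalIntegral.integral_const_mul, abs_mul, abs_of_nonneg hC] at hint
  rw [abs_of_nonneg (sub_nonneg.2 hE)] at hexp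
  rw [heq, abs_neg, abs_mul, abs_of_pos (by norm_num : (0 : ℝ) < 1 / 4), mul_assoc]
  gcongr
  refine hint.trans ?_
  gcongr
  linarith

/-- A Volterra equation with globally Lipschitz nonlinearity vanishing at `0` is solvable on `ℝ`. -/
theorem exists_volterraOp_fixedPoint {m L : ℝ} (hm : 0 ≤ m) (hL : 0 ≤ L) {f : ℝ → ℝ}
    (hf : Continuous f) (hf0 : f 0 = 0) (hlip : ∀ a b, |f a - f b| ≤ L * |a - b|) :
    ∃ V : ℝ → ℝ, Continuous V ∧ ∀ s, V s = volterraOp m f V s := by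
  let lift : BoundedContinuousFunction ℝ ℝ → ℝ → ℝ := fun g s => Real.exp (L * |s|) * g s
  have hlift : ∀ g, Continuous (lift g) := fun g => by
    have := g.continuous
    simp only [lift]
    fun_prop
  have hdist : ∀ (g h : BoundedContinuousFunction ℝ ℝ) (s : ℝ),
      |lift g s - lift h s| ≤ dist g h * Real.exp (L * |s|) := by
    intro g h s
    simp only [lift]
    rw [← mul_sub, abs_mul, abs_of_pos (Real.exp_pos _), mul_comm]
    gcongr
    exact BoundedContinuousFunction.dist_coe_le_dist (f := g) (g := h) s
  have hest : ∀ (g h : BoundedContinuousFunction ℝ ℝ) (s : ℝ),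
      |volterraOp m f (lift g) s - volterraOp m f (lift h) s| ≤
      1 / 4 * dist g h * Real.exp (L * |s|) := fun g h s =>
    abs_volterraOp_sub_le hm hL dist_nonneg hf hlip (hlift g) (hlift h) (hdist g h) s
  have hzero : ∀ s, volterraOp m f (lift 0) s = 1 := by
    intro s
    simp [volterraOp, weightedMean, lift, hf0]
  have hcancel : ∀ s, Real.exp (-(L * |s|)) * Real.exp (L * |s|) = 1 := fun s => by
    rw [← Real.exp_add]; simp
  have hbound : ∀ g s, ‖Real.exp (-(L * |s|)) * volterraOp m f (lift g) s‖ ≤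
      1 + 1 / 4 * dist g 0 := by
    intro g s
    have h1 := hest g 0 s
    rw [hzero] at h1
    have h2 : |volterraOp m f (lift g) s| ≤ 1 + 1 / 4 * dist g 0 * Real.exp (L * |s|) := by
      have := abs_add_le (volterraOp m f (lift g) s - 1) 1
      simp only [sub_add_cancel, abs_one] at this
      linarith
    rw [Real.norm_eq_abs, abs_mul, abs_of_pos (Real.exp_pos _)]
    have h3 : Real.exp (-(L * |s|)) ≤ 1 := Real.exp_le_one_iff.2 (by simp; positivity)
    calc _ ≤ Real.exp (-(L * |s|)) * (1 + 1 / 4 * dist g 0 * Real.exp (L * |s|)) := by gcongr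
      _ = Real.exp (-(L * |s|)) + 1 / 4 * dist g 0 *
          (Real.exp (-(L * |s|)) * Real.exp (L * |s|)) := by ring
      _ ≤ _ := by rw [hcancel]; linarith
  let Φ : BoundedContinuousFunction ℝ ℝ → BoundedContinuousFunction ℝ ℝ := fun g =>
    .ofNormedAddCommGroup (fun s => Real.exp (-(L * |s|)) * volterraOp m f (lift g) s)
      (by have := continuous_volterraOp hm hf (hlift g); fun_prop) _ (hbound g)
  have hΦ : ∀ g s, Φ g s = Real.exp (-(L * |s|)) * volterraOp m f (lift g) s := fun g s => rfl
  have hcontr : ContractingWith (1 / 4) Φ := by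
    refine ⟨by rw [div_lt_one (by norm_num)]; norm_num, LipschitzWith.of_dist_le_mul fun g h => ?_⟩
    refine (BoundedContinuousFunction.dist_le (by positivity)).2 fun s => ?_
    rw [Real.dist_eq, hΦ, hΦ, ← mul_sub, abs_mul, abs_of_pos (Real.exp_pos _)]
    calc _ ≤ Real.exp (-(L * |s|)) * (1 / 4 * dist g h * Real.exp (L * |s|)) := by
          gcongr; exact hest g h s
      _ = 1 / 4 * dist g h * (Real.exp (-(L * |s|)) * Real.exp (L * |s|)) := by ring
      _ = _ := by rw [hcancel]; simp
  have hfix := hcontr.fixedPoint_isFixedPt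
  refine ⟨lift (ContractingWith.fixedPoint Φ hcontr), hlift _, fun s => ?_⟩
  have h := hΦ (ContractingWith.fixedPoint Φ hcontr) s
  rw [hfix] at h
  have : lift (ContractingWith.fixedPoint Φ hcontr) s =
      Real.exp (L * |s|) * (ContractingWith.fixedPoint Φ hcontr) s := rfl
  rw [this, h, ← mul_assoc, mul_comm (Real.exp (L * |s|)), hcancel, one_mul]

/-- The derivative of `weightedMean m f V` given the derivatives of `f` and `V`. -/
def weightedMeanDeriv (m : ℝ) (f' V V' : ℝ → ℝ) (s : ℝ) : ℝ :=
  ∫ σ in (0 : ℝ)..1, σ ^ m * (f' (V (σ * s)) * (V' (σ * s) * σ))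

lemma continuous_weightedMeanDeriv {m : ℝ} (hm : 0 ≤ m) {f' V V' : ℝ → ℝ} (hf' : Continuous f')
    (hV : Continuous V) (hV' : Continuous V') : Continuous (weightedMeanDeriv m f' V V') := by
  unfold weightedMeanDeriv
  apply intervalIntegral.continuous_parametric_intervalIntegral_of_continuous'
  have h := Real.continuous_rpow_const hm
  simp only [Function.uncurry_def]
  fun_prop

lemma hasDerivAt_weightedMean {m : ℝ} (hm : 0 ≤ m) {f f' V V' : ℝ → ℝ}
    (hf : ∀ w, HasDerivAt f (f' w) w) (hf' : Continuous f')
    (hV : ∀ s, HasDerivAt V (V' s) s) (hV' : Continuous V') (s : ℝ) :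
    HasDerivAt (weightedMean m f V) (weightedMeanDeriv m f' V V' s) s := by
  have hcm := Real.continuous_rpow_const hm
  have hcV : Continuous V := continuous_iff_continuousAt.2 fun s => (hV s).continuousAt
  have hcf : Continuous f := continuous_iff_continuousAt.2 fun s => (hf s).continuousAt
  have hcont : Continuous fun q : ℝ × ℝ =>
      q.2 ^ m * (f' (V (q.2 * q.1)) * (V' (q.2 * q.1) * q.2)) := by
    fun_prop
  obtain ⟨C, hC⟩ := ((isCompact_closedBall s 1).prod (isCompact_Icc (a := (0 : ℝ)) (b := 1))
    ).exists_bound_of_continuousOn hcont.continuousOn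
  refine (intervalIntegral.hasDerivAt_integral_of_dominated_loc_of_deriv_le
    (μ := MeasureTheory.volume) (a := (0 : ℝ)) (b := 1) (s := closedBall s 1)
    (bound := fun _ => C) (F := fun x σ => σ ^ m * f (V (σ * x)))
    (F' := fun x σ => σ ^ m * (f' (V (σ * x)) * (V' (σ * x) * σ)))
    (closedBall_mem_nhds s one_pos) (.of_forall fun x => ?_) ?_ ?_ ?_ ?_ ?_).2
  · exact Continuous.aestronglyMeasurable (by fun_prop)
  · exact Continuous.intervalIntegrable (by fun_prop) _ _
  · exact Continuous.aestronglyMeasurable (by fun_prop)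
  · refine .of_forall fun σ hσ x hx => ?_
    rw [uIoc_of_le zero_le_one] at hσ
    exact hC (x, σ) ⟨hx, hσ.1.le, hσ.2⟩
  · exact intervalIntegrable_const
  · refine .of_forall fun σ _ x _ => ?_
    have h1 : HasDerivAt (fun x : ℝ => σ * x) σ x := by
      simpa using (hasDerivAt_id x).const_mul σ
    exact ((hf _).comp x ((hV (σ * x)).comp x h1)).const_mul _

lemma weightedMean_ode {m : ℝ} (hm : 0 ≤ m) {f f' V V' : ℝ → ℝ}
    (hf : ∀ w, HasDerivAt f (f' w) w) (hf' : Continuous f')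
    (hV : ∀ s, HasDerivAt V (V' s) s) (hV' : Continuous V') (s : ℝ) :
    s * weightedMeanDeriv m f' V V' s + (m + 1) * weightedMean m f V s = f (V s) := by
  have hcm := Real.continuous_rpow_const hm
  have hcV : Continuous V := continuous_iff_continuousAt.2 fun s => (hV s).continuousAt
  have hcf : Continuous f := continuous_iff_continuousAt.2 fun s => (hf s).continuousAt
  have hFTC : ∫ σ in (0 : ℝ)..1, (s * (σ ^ m * (f' (V (σ * s)) * (V' (σ * s) * σ))) +
      (m + 1) * (σ ^ m * f (V (σ * s)))) = f (V s) := by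
    rw [intervalIntegral.integral_eq_sub_of_hasDerivAt_of_le zero_le_one
      (f := fun σ => σ ^ (m + 1) * f (V (σ * s)))]
    · simp [Real.zero_rpow (by linarith : m + 1 ≠ 0)]
    · have := Real.continuous_rpow_const (by linarith : 0 ≤ m + 1)
      exact Continuous.continuousOn (by fun_prop)
    · intro σ hσ
      have h1 : HasDerivAt (fun σ : ℝ => σ * s) s σ := by
        simpa using (hasDerivAt_id σ).mul_const s
      have h2 := (Real.hasDerivAt_rpow_const (p := m + 1) (Or.inl hσ.1.ne')).mul
        ((hf _).comp σ ((hV (σ * s)).comp σ h1))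
      refine h2.congr_deriv ?_
      simp only [Function.comp_apply, add_sub_cancel_right, Real.rpow_add_one hσ.1.ne']
      ring
    · exact Continuous.intervalIntegrable (by fun_prop) _ _
  rw [intervalIntegral.integral_add (Continuous.intervalIntegrable (by fun_prop) _ _)
    (Continuous.intervalIntegrable (by fun_prop) _ _), intervalIntegral.integral_const_mul,
    intervalIntegral.integral_const_mul] at hFTC
  exact hFTC

lemma exists_first_zero {V : ℝ → ℝ} (hV : Continuous V) (h0 : 0 < V 0) {s : ℝ} (hs : 0 ≤ s)
    (hVs : V s ≤ 0) : ∃ a, 0 < a ∧ V a = 0 ∧ ∀ t ∈ Ico 0 a, 0 < V t := by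
  have hzero : ∀ t, 0 ≤ t → V t ≤ 0 → ∃ z ∈ Icc 0 t, V z = 0 := fun t ht hVt =>
    intermediate_value_Icc' ht hV.continuousOn ⟨hVt, h0.le⟩
  obtain ⟨z, hz, hVz⟩ := hzero s hs hVs
  have hcomp : IsCompact (Icc 0 s ∩ V ⁻¹' {0}) :=
    isCompact_Icc.inter_right (isClosed_singleton.preimage hV)
  obtain ⟨a, ⟨ha, hVa⟩, hleast⟩ := hcomp.exists_isLeast ⟨z, hz, hVz⟩
  refine ⟨a, lt_of_le_of_ne ha.1 ?_, hVa, fun t ht => ?_⟩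
  · rintro rfl
    exact h0.ne' hVa
  · by_contra hVt
    obtain ⟨y, hy, hVy⟩ := hzero t ht.1 (not_lt.1 hVt)
    exact absurd (hleast ⟨⟨hy.1, hy.2.trans (ht.2.le.trans ha.2)⟩, hVy⟩)
      (not_le.2 (hy.2.trans_lt ht.2))

/-- The Pohozaev identity: in the critical and supercritical range the derivative of a radial
solution vanishes at its first zero. -/
lemma eq_zero_of_first_zero {m p a : ℝ} (hm : 0 < m) (hp : 2 * (m + 1) ≤ m * p) (ha : 0 < a)
    {V M D : ℝ → ℝ} (hV : ∀ s, HasDerivAt V (-(1 / 4 * M s)) s) (hM : ∀ s, HasDerivAt M (D s) s)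
    (hode : ∀ s ∈ Ioo 0 a, s * D s + (m + 1) * M s = p * V s ^ (p - 1))
    (hpos : ∀ s ∈ Ico 0 a, 0 < V s) (hVa : V a = 0) : M a = 0 := by
  have hp0 : 0 < p := by
    by_contra h
    nlinarith [mul_nonneg hm.le (neg_nonneg.2 (not_lt.1 h))]
  have hcV : Continuous V := continuous_iff_continuousAt.2 fun s => (hV s).continuousAt
  have hcM : Continuous M := continuous_iff_continuousAt.2 fun s => (hM s).continuousAt
  have hcm := Real.continuous_rpow_const (by linarith : 0 ≤ m + 1)
  have hcp := Real.continuous_rpow_const hp0.le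
  let P : ℝ → ℝ := fun s => s ^ (m + 1) * (s * M s ^ 2 / 8 + V s ^ p - m / 2 * (V s * M s))
  have hderiv : ∀ s ∈ Ioo 0 a,
      HasDerivAt P (s ^ m * (V s ^ p * (m + 1 - m * p / 2))) s := by
    intro s hs
    have hVs := hpos s ⟨hs.1.le, hs.2⟩
    have h := (Real.hasDerivAt_rpow_const (p := m + 1) (Or.inl hs.1.ne')).mul
      (((((hasDerivAt_id s).mul ((hM s).pow 2)).div_const 8).add
        ((hV s).rpow_const (p := p) (Or.inl hVs.ne'))).sub
          (((hV s).mul (hM s)).const_mul (m / 2)))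
    refine h.congr_deriv ?_
    have hVp : V s ^ p = V s ^ (p - 1) * V s := by
      rw [← Real.rpow_add_one hVs.ne']; simp
    simp only [add_sub_cancel_right, Real.rpow_add_one hs.1.ne', id, Pi.mul_apply, Pi.pow_apply,
      Pi.add_apply, Pi.sub_apply, hVp]
    linear_combination s ^ m * (s * M s / 4 - m / 2 * V s) * hode s hs
  have hanti : AntitoneOn P (Icc 0 a) := by
    refine antitoneOn_of_deriv_nonpos (convex_Icc 0 a) (Continuous.continuousOn (by fun_prop))
      ?_ ?_
    · rw [interior_Icc]
      exact fun s hs => (hderiv s hs).differentiableAt.differentiableWithinAt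
    · rw [interior_Icc]
      intro s hs
      rw [(hderiv s hs).deriv]
      have h1 := Real.rpow_nonneg hs.1.le m
      have h2 := Real.rpow_nonneg (hpos s ⟨hs.1.le, hs.2⟩).le p
      exact mul_nonpos_of_nonneg_of_nonpos h1
        (mul_nonpos_of_nonneg_of_nonpos h2 (by linarith))
  have h := hanti ⟨le_rfl, ha.le⟩ ⟨ha.le, le_rfl⟩ ha.le
  simp only [P, hVa, Real.zero_rpow hp0.ne', Real.zero_rpow (by linarith : m + 1 ≠ 0)] at h
  have h1 := Real.rpow_pos_of_pos ha (m + 1)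
  by_contra hMa
  have : 0 < a * M a ^ 2 / 8 := by positivity
  nlinarith [mul_pos h1 this]

/-- A globally Lipschitz `C¹` function equal to `p w^(p-1)` on `[0, 1]`. -/
def truncPower (p w : ℝ) : ℝ :=
  ∫ t in (0 : ℝ)..w, p * (p - 1) * max 0 (min t 1) ^ (p - 2)

lemma continuous_truncPower_deriv {p : ℝ} (hp : 2 ≤ p) :
    Continuous fun t : ℝ => p * (p - 1) * max 0 (min t 1) ^ (p - 2) := by
  have h := Real.continuous_rpow_const (by linarith : 0 ≤ p - 2)
  fun_prop

lemma hasDerivAt_truncPower {p : ℝ} (hp : 2 ≤ p) (w : ℝ) :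
    HasDerivAt (truncPower p) (p * (p - 1) * max 0 (min w 1) ^ (p - 2)) w :=
  ((continuous_truncPower_deriv hp).integral_hasStrictDerivAt 0 w).hasDerivAt

lemma abs_truncPower_sub_le {p : ℝ} (hp : 2 ≤ p) (a b : ℝ) :
    |truncPower p a - truncPower p b| ≤ p * (p - 1) * |a - b| := by
  refine convex_univ.norm_image_sub_le_of_norm_hasDerivWithin_le (𝕜 := ℝ)
    (fun w _ => (hasDerivAt_truncPower hp w).hasDerivWithinAt) (fun w _ => ?_)
    (mem_univ b) (mem_univ a)
  have h0 : 0 ≤ max 0 (min w 1) := le_max_left _ _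
  have h1 : max 0 (min w 1) ≤ 1 := max_le zero_le_one (min_le_right _ _)
  have h2 : 0 ≤ p * (p - 1) := mul_nonneg (by linarith) (by linarith)
  rw [Real.norm_eq_abs, abs_of_nonneg (mul_nonneg h2 (Real.rpow_nonneg h0 _))]
  exact mul_le_of_le_one_right h2 (Real.rpow_le_one h0 h1 (by linarith))

lemma truncPower_eq {p : ℝ} (hp : 2 ≤ p) {w : ℝ} (h0 : 0 ≤ w) (h1 : w ≤ 1) :
    truncPower p w = p * w ^ (p - 1) := by
  unfold truncPower
  rw [intervalIntegral.integral_congr (g := fun t => p * (p - 1) * t ^ (p - 2)),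
    intervalIntegral.integral_const_mul, integral_rpow (Or.inl (by linarith)),
    show p - 2 + 1 = p - 1 by ring, Real.zero_rpow (by linarith)]
  · have : p - 1 ≠ 0 := by linarith
    field_simp
    ring
  · intro t ht
    rw [uIcc_of_le h0] at ht
    simp [min_eq_left (ht.2.trans h1), max_eq_right ht.1]

lemma truncPower_nonneg {p : ℝ} (hp : 2 ≤ p) {w : ℝ} (h0 : 0 ≤ w) : 0 ≤ truncPower p w :=
  intervalIntegral.integral_nonneg h0 fun _ _ =>
    mul_nonneg (mul_nonneg (by linarith) (by linarith)) (Real.rpow_nonneg (le_max_left _ _) _)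

lemma le_one_of_nonneg {m p a : ℝ} (hp : 2 ≤ p) {V : ℝ → ℝ} (h0 : V 0 = 1)
    (hV : ∀ s, HasDerivAt V (-(1 / 4 * weightedMean m (truncPower p) V s)) s)
    (hnonneg : ∀ s ∈ Icc 0 a, 0 ≤ V s) {s : ℝ} (hs : s ∈ Icc 0 a) : V s ≤ 1 := by
  have hcV : Continuous V := continuous_iff_continuousAt.2 fun s => (hV s).continuousAt
  have hanti : AntitoneOn V (Icc 0 a) := by
    refine antitoneOn_of_deriv_nonpos (convex_Icc 0 a) hcV.continuousOn
      (fun s _ => (hV s).differentiableAt.differentiableWithinAt) fun s hs => ?_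
    rw [interior_Icc] at hs
    rw [(hV s).deriv]
    have : 0 ≤ weightedMean m (truncPower p) V s := by
      refine intervalIntegral.integral_nonneg zero_le_one fun σ hσ => ?_
      refine mul_nonneg (Real.rpow_nonneg hσ.1 _) (truncPower_nonneg hp (hnonneg _ ⟨?_, ?_⟩))
      · exact mul_nonneg hσ.1 hs.1.le
      · exact (mul_le_of_le_one_left hs.1.le hσ.2).trans hs.2.le
    linarith
  rw [← h0]
  exact hanti ⟨le_rfl, hs.1.trans hs.2⟩ hs hs.1

/-- Critical and supercritical Lane–Emden profiles, as functions of `s = r²`. -/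
theorem exists_laneEmden_profile {m p : ℝ} (hm : 0 < m) (hp : 2 * (m + 1) ≤ m * p) :
    ∃ V V' V'' : ℝ → ℝ, (∀ s, HasDerivAt V (V' s) s) ∧ (∀ s, HasDerivAt V' (V'' s) s) ∧
      Continuous V'' ∧ (∀ s, 0 ≤ s → 0 < V s) ∧
      ∀ s, 0 ≤ s → 4 * s * V'' s + 4 * (m + 1) * V' s = -(p * V s ^ (p - 1)) := by
  have hp2 : 2 ≤ p := by nlinarith
  have hf := hasDerivAt_truncPower hp2
  have hf' := continuous_truncPower_deriv hp2
  have hcf : Continuous (truncPower p) := continuous_iff_continuousAt.2 fun s => (hf s).continuousAt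
  obtain ⟨V, hcV, hfix⟩ := exists_volterraOp_fixedPoint hm.le
    (mul_nonneg (by linarith) (by linarith) : 0 ≤ p * (p - 1)) hcf (by simp [truncPower])
    (abs_truncPower_sub_le hp2)
  have hcM := continuous_weightedMean hm.le hcf hcV
  have h0 : V 0 = 1 := by rw [hfix]; simp [volterraOp]
  have hV : ∀ s, HasDerivAt V (-(1 / 4 * weightedMean m (truncPower p) V s)) s := by
    intro s
    refine HasDerivAt.congr_of_eventuallyEq ?_ (.of_forall hfix)
    exact ((hcM.integral_hasStrictDerivAt 0 s).hasDerivAt.const_mul (1 / 4)).const_sub 1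
  have hcV' : Continuous fun s => -(1 / 4 * weightedMean m (truncPower p) V s) := by fun_prop
  have hM := hasDerivAt_weightedMean hm.le hf hf' hV hcV'
  have hode := weightedMean_ode hm.le hf hf' hV hcV'
  have hpos : ∀ s, 0 ≤ s → 0 < V s := by
    intro s hs
    by_contra hVs
    obtain ⟨a, ha, hVa, hpa⟩ := exists_first_zero hcV (by rw [h0]; exact one_pos) hs
      (not_lt.1 hVs)
    have hnn : ∀ t ∈ Icc 0 a, 0 ≤ V t := fun t ht =>
      ht.2.eq_or_lt.elim (fun h => (h ▸ hVa).ge) fun h => (hpa t ⟨ht.1, h⟩).le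
    have hle : ∀ t ∈ Icc 0 a, V t ≤ 1 := fun t ht => le_one_of_nonneg hp2 h0 hV hnn ht
    have hMa := eq_zero_of_first_zero hm hp ha hV hM (fun t ht => by
      rw [hode, truncPower_eq hp2 (hnn t ⟨ht.1.le, ht.2.le⟩) (hle t ⟨ht.1.le, ht.2.le⟩)]) hpa hVa
    have hcm := Real.continuous_rpow_const hm.le
    refine hMa.not_gt (intervalIntegral.intervalIntegral_pos_of_pos_on
      (Continuous.intervalIntegrable (by fun_prop) _ _) (fun σ hσ => ?_) one_pos)
    have hσa : σ * a < a := mul_lt_of_lt_one_left ha hσ.2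
    have hσa0 : 0 < σ * a := mul_pos hσ.1 ha
    rw [truncPower_eq hp2 (hnn _ ⟨hσa0.le, hσa.le⟩) (hle _ ⟨hσa0.le, hσa.le⟩)]
    have h1 := Real.rpow_pos_of_pos (hpa _ ⟨hσa0.le, hσa⟩) (p - 1)
    have h2 := Real.rpow_pos_of_pos hσ.1 m
    have h3 : 0 < p := by linarith
    positivity
  refine ⟨V, _, _, hV, fun s => ((hM s).const_mul (1 / 4)).neg, ?_, hpos, fun s hs => ?_⟩
  · have := continuous_weightedMeanDeriv hm.le hf' hcV hcV'
    fun_prop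
  · have hle := le_one_of_nonneg hp2 h0 hV (fun t ht => (hpos t ht.1).le) ⟨hs, le_rfl⟩
    rw [← truncPower_eq hp2 (hpos s hs).le hle, ← hode s]
    ring

lemma contDiff_two_of_hasDerivAt {V V' V'' : ℝ → ℝ} (hV : ∀ s, HasDerivAt V (V' s) s)
    (hV' : ∀ s, HasDerivAt V' (V'' s) s) (hV'' : Continuous V'') : ContDiff ℝ 2 V := by
  have hd : deriv V = V' := funext fun s => (hV s).deriv
  have hd' : deriv V' = V'' := funext fun s => (hV' s).deriv
  rw [show (2 : WithTop ℕ∞) = 1 + 1 by norm_num, contDiff_succ_iff_deriv, hd,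
    contDiff_one_iff_deriv, hd']
  refine ⟨fun s => (hV s).differentiableAt, by simp, ?_⟩
  exact ⟨fun s => (hV' s).differentiableAt, hV''⟩

lemma lap_comp_norm_sq {n : ℕ} {V V' V'' : ℝ → ℝ} (hV : ∀ s, HasDerivAt V (V' s) s)
    (hV' : ∀ s, HasDerivAt V' (V'' s) s) (x : EuclideanSpace ℝ (Fin n)) :
    lap (fun y => V (‖y‖ ^ 2)) x = 4 * ‖x‖ ^ 2 * V'' (‖x‖ ^ 2) + 2 * n * V' (‖x‖ ^ 2) := by
  have hsq : ∀ y : EuclideanSpace ℝ (Fin n),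
      HasFDerivAt (fun y => ‖y‖ ^ 2) (2 • innerSL ℝ y) y := fun y => by
    simpa using (hasFDerivAt_id y).norm_sq
  have hgrad : ∀ (y : EuclideanSpace ℝ (Fin n)) i,
      fderiv ℝ (fun y => V (‖y‖ ^ 2)) y (EuclideanSpace.single i 1) =
        V' (‖y‖ ^ 2) * (2 * y i) := by
    intro y i
    have h : HasFDerivAt (fun y => V (‖y‖ ^ 2)) _ y := (hV _).comp_hasFDerivAt y (hsq y)
    rw [h.fderiv]
    simp [EuclideanSpace.inner_single_right]
  have hcoord : ∀ i, HasFDerivAt (fun y : EuclideanSpace ℝ (Fin n) => 2 * y i)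
      ((2 : ℝ) • (EuclideanSpace.proj i : EuclideanSpace ℝ (Fin n) →L[ℝ] ℝ)) x := fun i =>
    (EuclideanSpace.proj i : EuclideanSpace ℝ (Fin n) →L[ℝ] ℝ).hasFDerivAt.const_mul 2
  have hhess : ∀ i, fderiv ℝ (fun y : EuclideanSpace ℝ (Fin n) => V' (‖y‖ ^ 2) * (2 * y i)) x
      (EuclideanSpace.single i 1) = 4 * V'' (‖x‖ ^ 2) * x i ^ 2 + 2 * V' (‖x‖ ^ 2) := by
    intro i
    have h : HasFDerivAt (fun y : EuclideanSpace ℝ (Fin n) => V' (‖y‖ ^ 2) * (2 * y i)) _ x :=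
      ((hV' _).comp_hasFDerivAt x (hsq x)).mul (hcoord i)
    rw [h.fderiv]
    simp [EuclideanSpace.inner_single_right]
    ring
  simp only [lap, hgrad, hhess]
  rw [Finset.sum_add_distrib, ← Finset.mul_sum, EuclideanSpace.real_norm_sq_eq]
  simp
  ring

/-- **Existence for the Type II cross-gradient system** coming from the potential
`F(u,v) = -(u-v)² + u^p + v^p`: for `p ≥ 2n/(n-2)` the system
`-Δu = -2(u-v) + p v^(p-1)`, `-Δv = 2(u-v) + p u^(p-1)` admits a positive radially
symmetric C² solution in `ℝ^n`. -/
theorem typeII_example_existence (n : ℕ) (hn : 3 ≤ n) (p : ℝ)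
    (hp : 2 * (n:ℝ) / ((n:ℝ) - 2) ≤ p) :
    ∃ u v : EuclideanSpace ℝ (Fin n) → ℝ,
      ContDiff ℝ 2 u ∧ ContDiff ℝ 2 v ∧
      (∀ x, 0 < u x) ∧ (∀ x, 0 < v x) ∧
      (∀ x y : EuclideanSpace ℝ (Fin n), ‖x‖ = ‖y‖ → u x = u y) ∧
      (∀ x y : EuclideanSpace ℝ (Fin n), ‖x‖ = ‖y‖ → v x = v y) ∧
      (∀ x, - lap u x = -2 * (u x - v x) + p * v x ^ (p - 1)) ∧
      (∀ x, - lap v x = 2 * (u x - v x) + p * u x ^ (p - 1)) := by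
  have hn3 : (3 : ℝ) ≤ n := by exact_mod_cast hn
  have hn2 : (0 : ℝ) < (n : ℝ) - 2 := by linarith
  rw [div_le_iff₀ hn2] at hp
  obtain ⟨V, V', V'', hV, hV', hV'', hpos, hode⟩ := exists_laneEmden_profile
    (m := (n : ℝ) / 2 - 1) (p := p) (by linarith) (by linarith)
  have hC : ContDiff ℝ 2 fun x : EuclideanSpace ℝ (Fin n) => V (‖x‖ ^ 2) :=
    (contDiff_two_of_hasDerivAt hV hV' hV'').comp (contDiff_norm_sq ℝ)
  have hlap : ∀ x : EuclideanSpace ℝ (Fin n),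
      -lap (fun y => V (‖y‖ ^ 2)) x = p * V (‖x‖ ^ 2) ^ (p - 1) := by
    intro x
    rw [lap_comp_norm_sq hV hV']
    linarith [hode (‖x‖ ^ 2) (sq_nonneg _)]
  refine ⟨_, _, hC, hC, fun x => hpos _ (sq_nonneg _), fun x => hpos _ (sq_nonneg _),
    fun x y h => by simp only [h], fun x y h => by simp only [h], fun x => ?_, fun x => ?_⟩
  · rw [hlap]; ring
  · rw [hlap]; ring
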